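/- Fix 0 ≤ ℓ < u ≤ K, positive thresholds a,b,c,d, and A ⊆ [K] with ℓ ≤ |A| ≤ u. Under the singularity assumption on each stream, the gap-intersection rule satisfies P_A(T_GI < ∞) = 1, and its familywise error probabilities satisfy P_A(A ≲ d_GI) ≤ |A^c|(e^{−b} + |A| e^{−c}) and P_A(d_GI ≲ A) ≤ |A|(e^{−a} + |A^c| e^{−d}). -/

import Mathlib

open MeasureTheory ProbabilityTheory Filter Set
open scoped ENNReal NNReal Topology Classical

noncomputable section

namespace SeqMT

variable {Ω : Type*}

/-- The `m`-th largest value (1-indexed, for `1 ≤ m ≤ K`) among `v 0, …, v (K-1)`. -/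
noncomputable def orderStat {K : ℕ} (v : Fin K → ℝ) (m : ℕ) : ℝ :=
  ((Finset.univ.val.map v).sort (· ≤ ·)).getD (K - m) 0

/-- The number of strictly positive entries of `v`. -/
noncomputable def posCount {K : ℕ} (v : Fin K → ℝ) : ℕ :=
  (Finset.univ.filter fun k => 0 < v k).card

/-- The rank (0-indexed) of stream `k`, ordering by value (descending) with ties broken
by stream index: `rankOf v k = r` means `k = i_{r+1}`. -/
noncomputable def rankOf {K : ℕ} (v : Fin K → ℝ) (k : Fin K) : ℕ :=
  (Finset.univ.filter fun j => v k < v j ∨ (v j = v k ∧ j < k)).card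

/-- The set `{i_1, …, i_m}` of the `m` streams with the largest values. -/
noncomputable def topSet {K : ℕ} (v : Fin K → ℝ) (m : ℕ) : Finset (Fin K) :=
  Finset.univ.filter fun k => rankOf v k < m

/-- First time `n ≥ 1` at which `Q n` holds (`⊤` if it never does). -/
noncomputable def stopTime (Q : ℕ → Ω → Prop) (ω : Ω) : ℕ∞ :=
  sInf {n : ℕ∞ | ∃ m : ℕ, n = (m : ℕ∞) ∧ 1 ≤ m ∧ Q m ω}

/-- The log-likelihood ratio process `λ^{A,C}` of `P_A` versus `P_C`. -/
def llrAC {K : ℕ} (lam : Fin K → ℕ → Ω → ℝ) (A C : Finset (Fin K)) (n : ℕ) (ω : Ω) : ℝ :=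
  ∑ k ∈ A \ C, lam k n ω - ∑ k ∈ C \ A, lam k n ω

/-- The gap rule stopping time `T_G`. -/
noncomputable def gapTime {K : ℕ} (lam : Fin K → ℕ → Ω → ℝ) (m : ℕ) (c : ℝ) : Ω → ℕ∞ :=
  stopTime fun n ω =>
    c ≤ orderStat (fun k => lam k n ω) m - orderStat (fun k => lam k n ω) (m + 1)

/-- The gap rule decision `d_G = {i_1(T_G), …, i_m(T_G)}`. -/
noncomputable def gapDecision {K : ℕ} (lam : Fin K → ℕ → Ω → ℝ) (m : ℕ) (c : ℝ)
    (ω : Ω) : Finset (Fin K) :=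
  topSet (fun k => lam k (gapTime lam m c ω).toNat ω) m

/-- `τ₁` (with the convention `λ^{(0)} = -∞`, so `τ₁ = ∞` when `ℓ = 0`). -/
noncomputable def tau1 {K : ℕ} (lam : Fin K → ℕ → Ω → ℝ) (ℓ : ℕ) (a c : ℝ) : Ω → ℕ∞ :=
  stopTime fun n ω => 1 ≤ ℓ ∧ orderStat (fun k => lam k n ω) (ℓ + 1) ≤ -a ∧
    c ≤ orderStat (fun k => lam k n ω) ℓ - orderStat (fun k => lam k n ω) (ℓ + 1)

/-- `τ₂`. -/
noncomputable def tau2 {K : ℕ} (lam : Fin K → ℕ → Ω → ℝ) (ℓ u : ℕ) (a b : ℝ) : Ω → ℕ∞ :=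
  stopTime fun n ω => ℓ ≤ posCount (fun k => lam k n ω) ∧ posCount (fun k => lam k n ω) ≤ u ∧
    ∀ k : Fin K, lam k n ω ∉ Set.Ioo (-a) b

/-- `τ₃` (with the convention `λ^{(K+1)} = ∞`, so `τ₃ = ∞` when `u = K`). -/
noncomputable def tau3 {K : ℕ} (lam : Fin K → ℕ → Ω → ℝ) (u : ℕ) (b d : ℝ) : Ω → ℕ∞ :=
  stopTime fun n ω => u < K ∧ b ≤ orderStat (fun k => lam k n ω) u ∧
    d ≤ orderStat (fun k => lam k n ω) u - orderStat (fun k => lam k n ω) (u + 1)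

/-- The gap-intersection stopping time `T_GI = min{τ₁, τ₂, τ₃}`. -/
noncomputable def giTime {K : ℕ} (lam : Fin K → ℕ → Ω → ℝ) (ℓ u : ℕ) (a b c d : ℝ) :
    Ω → ℕ∞ := fun ω =>
  min (tau1 lam ℓ a c ω) (min (tau2 lam ℓ u a b ω) (tau3 lam u b d ω))

/-- The gap-intersection decision `d_GI = {i_1(T_GI), …, i_{p'}(T_GI)}`,
`p' = min(max(p(T_GI), ℓ), u)`. -/
noncomputable def giDecision {K : ℕ} (lam : Fin K → ℕ → Ω → ℝ) (ℓ u : ℕ) (a b c d : ℝ)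
    (ω : Ω) : Finset (Fin K) :=
  topSet (fun k => lam k (giTime lam ℓ u a b c d ω).toNat ω)
    (min (max (posCount (fun k => lam k (giTime lam ℓ u a b c d ω).toNat ω)) ℓ) u)

/-- The intersection rule stopping time `T_I`. -/
noncomputable def interTime {K : ℕ} (lam : Fin K → ℕ → Ω → ℝ) (a b : ℝ) : Ω → ℕ∞ :=
  stopTime fun n ω => ∀ k : Fin K, lam k n ω ∉ Set.Ioo (-a) b

/-- The intersection rule decision `d_I`: streams with positive LLR at `T_I`. -/
noncomputable def interDecision {K : ℕ} (lam : Fin K → ℕ → Ω → ℝ) (a b : ℝ)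
    (ω : Ω) : Finset (Fin K) :=
  Finset.univ.filter fun k => 0 < lam k (interTime lam a b ω).toNat ω

/-- `φ(x,y) = x log(x/(1-y)) + (1-x) log((1-x)/y)`. -/
noncomputable def phi (x y : ℝ) : ℝ :=
  x * Real.log (x / (1 - y)) + (1 - x) * Real.log ((1 - x) / y)

/-- `γ_{A,C}(α,β)`. -/
noncomputable def gammaAC {K : ℕ} (A C : Finset (Fin K)) (α β : ℝ) : ℝ :=
  if (C \ A).Nonempty ∧ A \ C = ∅ then phi α β
  else if C \ A = ∅ ∧ (A \ C).Nonempty then phi β α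
  else max (phi α β) (phi β α)

/-- `min_{k ∈ S} D k`, as an extended nonnegative real (so `= ∞` when `S = ∅`). -/
noncomputable def eta {K : ℕ} (S : Finset (Fin K)) (D : Fin K → ℝ) : ℝ≥0∞ :=
  S.inf fun k => ENNReal.ofReal (D k)

/-- `T` is a stopping time of the filtration `F`. -/
def IsST (F : ℕ → MeasurableSpace Ω) (T : Ω → ℕ∞) : Prop :=
  ∀ n : ℕ, MeasurableSet[F n] {ω | T ω ≤ (n : ℕ∞)}

/-- `d` is an `F_T`-measurable decision. -/
def IsDecision {K : ℕ} (F : ℕ → MeasurableSpace Ω) (T : Ω → ℕ∞)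
    (d : Ω → Finset (Fin K)) : Prop :=
  ∀ (n : ℕ) (B : Finset (Fin K)), MeasurableSet[F n] {ω | d ω = B ∧ T ω = (n : ℕ∞)}

/-- `(T,d) ∈ Δ_{α,β}(Pcl)`: both familywise error probabilities are controlled for all `A ∈ Pcl`. -/
def InDelta {K : ℕ} [MeasurableSpace Ω] (P : Finset (Fin K) → Measure Ω) (Pcl : Set (Finset (Fin K)))
    (α β : ℝ) (T : Ω → ℕ∞) (d : Ω → Finset (Fin K)) : Prop :=
  ∀ A ∈ Pcl, (P A {ω | ¬ d ω ⊆ A}).toReal ≤ α ∧ (P A {ω | ¬ A ⊆ d ω}).toReal ≤ β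

/-- `inf_{(T,d) ∈ Δ_{α,β}(Pcl)} E_A[T]`. -/
noncomputable def optESS {K : ℕ} [MeasurableSpace Ω] (P : Finset (Fin K) → Measure Ω)
    (F : ℕ → MeasurableSpace Ω) (Pcl : Set (Finset (Fin K))) (α β : ℝ)
    (A : Finset (Fin K)) : ℝ≥0∞ :=
  ⨅ (T : Ω → ℕ∞) (d : Ω → Finset (Fin K))
    (_ : IsST F T ∧ IsDecision F T d ∧ InDelta P Pcl α β T d),
      ∫⁻ ω, (T ω : ℝ≥0∞) ∂ P A

end SeqMT

namespace SeqMT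

theorem rank_lt_of_prec {K : ℕ} (v : Fin K → ℝ) {j k : Fin K}
    (h : v k < v j ∨ (v j = v k ∧ j < k)) : rankOf v j < rankOf v k := by
  unfold rankOf
  apply Finset.card_lt_card
  rw [Finset.ssubset_iff_of_subset]
  · refine ⟨j, by simpa using h, by simp⟩
  · intro i hi
    simp only [Finset.mem_filter, Finset.mem_univ, true_and] at hi ⊢
    rcases hi with hi | ⟨hi, hi'⟩ <;> rcases h with h | ⟨h, h'⟩
    · left; linarith
    · left; linarith
    · left; linarith
    · right; exact ⟨hi.trans h, hi'.trans h'⟩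

theorem rank_lt_card {K : ℕ} (v : Fin K → ℝ) (k : Fin K) : rankOf v k < K := by
  have : rankOf v k < (Finset.univ : Finset (Fin K)).card := by
    unfold rankOf
    apply Finset.card_lt_card
    rw [Finset.ssubset_iff_of_subset (Finset.filter_subset _ _)]
    exact ⟨k, by simp, by simp⟩
  simpa using this

theorem exists_rank_equiv {K : ℕ} (v : Fin K → ℝ) :
    ∃ e : Fin K ≃ Fin K, ∀ k, (e k : ℕ) = rankOf v k := by
  let f : Fin K → Fin K := fun k => ⟨rankOf v k, rank_lt_card v k⟩
  have hinj : Function.Injective f := by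
    intro j k h
    have h' : rankOf v j = rankOf v k := congrArg Fin.val h
    by_contra hne
    rcases lt_trichotomy (v j) (v k) with h1 | h1 | h1
    · have := rank_lt_of_prec v (j := k) (k := j) (Or.inl h1); omega
    · rcases lt_or_gt_of_ne hne with h2 | h2
      · have := rank_lt_of_prec v (j := j) (k := k) (Or.inr ⟨h1, h2⟩); omega
      · have := rank_lt_of_prec v (j := k) (k := j) (Or.inr ⟨h1.symm, h2⟩); omega
    · have := rank_lt_of_prec v (j := j) (k := k) (Or.inl h1); omega
  exact ⟨Equiv.ofBijective f (Finite.injective_iff_bijective.mp hinj), fun k => rfl⟩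

theorem le_of_rank_le {K : ℕ} (v : Fin K → ℝ) {j k : Fin K}
    (h : rankOf v j ≤ rankOf v k) : v k ≤ v j := by
  by_contra hlt
  have := rank_lt_of_prec v (j := k) (k := j) (Or.inl (not_le.mp hlt))
  omega

theorem exists_orderStat {K : ℕ} (v : Fin K → ℝ) (m : ℕ) (h1 : 1 ≤ m) (hm : m ≤ K) :
    ∃ k, rankOf v k + 1 = m ∧ orderStat v m = v k := by
  obtain ⟨e, he⟩ := exists_rank_equiv v
  have hsort : (Finset.univ.val.map v).sort (· ≤ ·)
      = List.ofFn (fun i : Fin K => v (e.symm i.rev)) := by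
    apply List.Perm.eq_of_pairwise (le := (· ≤ ·))
    · intro x y _ _ hxy hyx
      exact le_antisymm hxy hyx
    · exact Multiset.pairwise_sort _ _
    · rw [List.pairwise_ofFn]
      intro i j hij
      apply le_of_rank_le
      rw [← he, ← he]
      simp only [Equiv.apply_symm_apply]
      exact_mod_cast (Fin.rev_le_rev.mpr hij.le)
    · rw [← Multiset.coe_eq_coe, Multiset.sort_eq]
      have h2 : (List.ofFn (fun i : Fin K => v (e.symm i.rev)) : Multiset ℝ)
          = Finset.univ.val.map (fun i : Fin K => v (e.symm i.rev)) := by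
        rw [Fin.univ_val_map]
      rw [h2]
      have := Multiset.map_univ_val_equiv (Fin.revPerm.trans e.symm)
      conv_lhs => rw [← this]
      rw [Multiset.map_map]
      rfl
  refine ⟨e.symm ⟨m - 1, by omega⟩, ?_, ?_⟩
  · rw [← he]; simp; omega
  · unfold orderStat
    rw [hsort, List.getD_eq_getElem _ _ (by simp; omega), List.getElem_ofFn]
    congr 2
    apply Fin.ext
    simp only [Fin.val_rev]
    omega

theorem card_topSet {K : ℕ} (v : Fin K → ℝ) (m : ℕ) (hm : m ≤ K) :
    (topSet v m).card = m := by
  obtain ⟨e, he⟩ := exists_rank_equiv v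
  have : (topSet v m).map e.toEmbedding = Finset.univ.filter (fun i : Fin K => (i : ℕ) < m) := by
    ext i
    simp only [topSet, Finset.mem_map_equiv, Finset.mem_filter, Finset.mem_univ, true_and, ← he,
      Equiv.apply_symm_apply]
  rw [← Finset.card_map e.toEmbedding, this, Fin.card_filter_val_lt]
  omega

theorem rank_lt_posCount {K : ℕ} (v : Fin K → ℝ) (k : Fin K) :
    rankOf v k < posCount v ↔ 0 < v k := by
  constructor
  · intro h
    by_contra hk
    have : posCount v ≤ rankOf v k := by
      unfold posCount rankOf
      apply Finset.card_le_card
      intro j hj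
      simp only [Finset.mem_filter, Finset.mem_univ, true_and] at hj ⊢
      left; linarith
    omega
  · intro h
    unfold posCount rankOf
    apply Finset.card_lt_card
    rw [Finset.ssubset_iff_of_subset]
    · exact ⟨k, by simpa using h, by simp⟩
    · intro j hj
      simp only [Finset.mem_filter, Finset.mem_univ, true_and] at hj ⊢
      rcases hj with hj | ⟨hj, _⟩ <;> linarith

theorem stopTime_spec {Ω : Type*} (Q : ℕ → Ω → Prop) (ω : Ω) (h : stopTime Q ω < ⊤) :
    Q (stopTime Q ω).toNat ω := by
  have hne : {n : ℕ∞ | ∃ m : ℕ, n = (m : ℕ∞) ∧ 1 ≤ m ∧ Q m ω}.Nonempty := by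
    by_contra hem
    rw [Set.not_nonempty_iff_eq_empty] at hem
    simp [stopTime, hem] at h
  have := csInf_mem hne
  obtain ⟨m, hm, -, hQ⟩ := this
  have h2 : stopTime Q ω = (m : ℕ∞) := hm
  rw [h2]
  simpa using hQ

theorem stopTime_lt_top {Ω : Type*} (Q : ℕ → Ω → Prop) (ω : Ω) (m : ℕ) (hm : 1 ≤ m)
    (h : Q m ω) : stopTime Q ω < ⊤ :=
  lt_of_le_of_lt (sInf_le ⟨m, rfl, hm, h⟩) (ENat.coe_lt_top m)

/-- The three possible stopping scenarios, at the level of a vector of statistics. -/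
theorem giTime_spec {Ω : Type*} {K : ℕ} (lam : Fin K → ℕ → Ω → ℝ) (ℓ u : ℕ) (a b c d : ℝ) (ω : Ω)
    (h : giTime lam ℓ u a b c d ω < ⊤) :
    let v : Fin K → ℝ := fun k => lam k (giTime lam ℓ u a b c d ω).toNat ω
    (1 ≤ ℓ ∧ orderStat v (ℓ + 1) ≤ -a ∧ c ≤ orderStat v ℓ - orderStat v (ℓ + 1)) ∨
    (ℓ ≤ posCount v ∧ posCount v ≤ u ∧ ∀ k : Fin K, v k ∉ Set.Ioo (-a) b) ∨
    (u < K ∧ b ≤ orderStat v u ∧ d ≤ orderStat v u - orderStat v (u + 1)) := by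
  intro v
  have h1 : giTime lam ℓ u a b c d ω = tau1 lam ℓ a c ω ∨
      giTime lam ℓ u a b c d ω = tau2 lam ℓ u a b ω ∨
      giTime lam ℓ u a b c d ω = tau3 lam u b d ω := by
    unfold giTime
    rcases min_choice (tau1 lam ℓ a c ω) (min (tau2 lam ℓ u a b ω) (tau3 lam u b d ω)) with h | h
    · exact Or.inl h
    · right
      rw [h]
      exact min_choice _ _
  rcases h1 with h1 | h1 | h1
  · left
    simp only [v, h1]
    rw [h1] at h
    exact stopTime_spec _ ω h
  · right; left
    simp only [v, h1]
    rw [h1] at h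
    exact stopTime_spec _ ω h
  · right; right
    simp only [v, h1]
    rw [h1] at h
    exact stopTime_spec _ ω h

/-- Deterministic analysis of an erroneous decision. -/
theorem decision_det {K : ℕ} (v : Fin K → ℝ) (ℓ u : ℕ) (hℓu : ℓ < u) (huK : u ≤ K)
    (a b c d : ℝ) (ha : 0 < a) (hb : 0 < b)
    (A : Finset (Fin K)) (hAl : ℓ ≤ A.card) (hAu : A.card ≤ u)
    (h : (1 ≤ ℓ ∧ orderStat v (ℓ + 1) ≤ -a ∧ c ≤ orderStat v ℓ - orderStat v (ℓ + 1)) ∨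
      (ℓ ≤ posCount v ∧ posCount v ≤ u ∧ ∀ k : Fin K, v k ∉ Set.Ioo (-a) b) ∨
      (u < K ∧ b ≤ orderStat v u ∧ d ≤ orderStat v u - orderStat v (u + 1))) :
    (∀ k ∈ topSet v (min (max (posCount v) ℓ) u), k ∉ A →
      b ≤ v k ∨ ∃ j ∈ A, c ≤ v k - v j) ∧
    (∀ j ∈ A, j ∉ topSet v (min (max (posCount v) ℓ) u) →
      v j ≤ -a ∨ ∃ k, k ∉ A ∧ d ≤ v k - v j) := by
  rcases h with ⟨hl, h1, h2⟩ | ⟨h1, h2, h3⟩ | ⟨huK', h1, h2⟩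
  · obtain ⟨x, hx, hx'⟩ := exists_orderStat v ℓ hl (by omega)
    obtain ⟨y, hy, hy'⟩ := exists_orderStat v (ℓ + 1) (by omega) (by omega)
    rw [hx', hy'] at h2
    rw [hy'] at h1
    have hp : posCount v ≤ ℓ := by
      have := mt (rank_lt_posCount v y).mp (by linarith)
      omega
    have hp' : min (max (posCount v) ℓ) u = ℓ := by omega
    rw [hp']
    have hcard := card_topSet v ℓ (by omega)
    constructor
    · intro k hk hkA
      right
      have hns : ¬ A ⊆ topSet v ℓ := by
        intro hs
        have := Finset.eq_of_subset_of_card_le hs (by omega)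
        exact hkA (this ▸ hk)
      obtain ⟨j, hjA, hj⟩ := Finset.not_subset.mp hns
      refine ⟨j, hjA, ?_⟩
      simp only [topSet, Finset.mem_filter, Finset.mem_univ, true_and, not_lt] at hj hk
      have e1 := le_of_rank_le v (j := k) (k := x) (by omega)
      have e2 := le_of_rank_le v (j := y) (k := j) (by omega)
      linarith
    · intro j hjA hj
      left
      simp only [topSet, Finset.mem_filter, Finset.mem_univ, true_and, not_lt] at hj
      have e2 := le_of_rank_le v (j := y) (k := j) (by omega)
      linarith
  · have hp' : min (max (posCount v) ℓ) u = posCount v := by omega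
    rw [hp']
    constructor
    · intro k hk _
      left
      simp only [topSet, Finset.mem_filter, Finset.mem_univ, true_and] at hk
      rw [rank_lt_posCount] at hk
      by_contra hlt
      exact h3 k ⟨by linarith, not_le.mp hlt⟩
    · intro j _ hj
      left
      simp only [topSet, Finset.mem_filter, Finset.mem_univ, true_and] at hj
      rw [rank_lt_posCount] at hj
      by_contra hlt
      exact h3 j ⟨not_le.mp hlt, by linarith⟩
  · obtain ⟨x, hx, hx'⟩ := exists_orderStat v u (by omega) (by omega)
    obtain ⟨y, hy, hy'⟩ := exists_orderStat v (u + 1) (by omega) (by omega)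
    rw [hx', hy'] at h2
    rw [hx'] at h1
    have hp : u ≤ posCount v := by
      have := (rank_lt_posCount v x).mpr (by linarith)
      omega
    have hp' : min (max (posCount v) ℓ) u = u := by omega
    rw [hp']
    have hcard := card_topSet v u (by omega)
    constructor
    · intro k hk hkA
      left
      simp only [topSet, Finset.mem_filter, Finset.mem_univ, true_and] at hk
      have e1 := le_of_rank_le v (j := k) (k := x) (by omega)
      linarith
    · intro j hjA hj
      right
      have hns : ¬ topSet v u ⊆ A := by
        intro hs
        have := Finset.eq_of_subset_of_card_le hs (by omega)
        exact hj (this ▸ hjA)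
      obtain ⟨k, hk, hkA⟩ := Finset.not_subset.mp hns
      refine ⟨k, hkA, ?_⟩
      simp only [topSet, Finset.mem_filter, Finset.mem_univ, true_and, not_lt] at hj hk
      have e1 := le_of_rank_le v (j := k) (k := x) (by omega)
      have e2 := le_of_rank_le v (j := y) (k := j) (by omega)
      linarith

/-- Maximal inequality for the likelihood ratio. -/
theorem maximal_ineq
    {Ω : Type*} [mΩ : MeasurableSpace Ω] {K : ℕ}
    (F : ℕ → MeasurableSpace Ω) (hFle : ∀ n, F n ≤ mΩ)
    (hFmono : Monotone F)
    (P : Finset (Fin K) → Measure Ω) [∀ A : Finset (Fin K), IsProbabilityMeasure (P A)]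
    (lam : Fin K → ℕ → Ω → ℝ)
    (hadapt : ∀ (k : Fin K) (n : ℕ), Measurable[F n] fun ω => lam k n ω)
    (hLR : ∀ (A C : Finset (Fin K)) (n : ℕ) (Γ : Set Ω), MeasurableSet[F n] Γ →
      (P A Γ).toReal = ∫ ω in Γ, Real.exp (llrAC lam A C n ω) ∂ P C)
    (A C : Finset (Fin K)) (t : ℝ) :
    P A {ω | ∃ n, llrAC lam A C n ω ≤ -t} ≤ ENNReal.ofReal (Real.exp (-t)) := by
  have hmeas : ∀ n, Measurable[F n] (llrAC lam A C n) := by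
    intro n
    unfold llrAC
    refine Measurable.sub ?_ ?_
    · exact Finset.measurable_fun_sum _ (fun k _ => hadapt k n)
    · exact Finset.measurable_fun_sum _ (fun k _ => hadapt k n)
  have hS : ∀ n, MeasurableSet[F n] {ω | llrAC lam A C n ω ≤ -t} := fun n =>
    hmeas n measurableSet_Iic
  let S : ℕ → Set Ω := fun n => {ω | llrAC lam A C n ω ≤ -t}
  have hD : ∀ n, MeasurableSet[F n] (disjointed S n) := by
    intro n
    rw [disjointed_eq_inter_compl]
    refine (hS n).inter ?_
    refine MeasurableSet.iInter fun m => MeasurableSet.iInter fun hm => ?_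
    exact (hFmono hm.le _ (hS m)).compl
  have hint : ∀ n, Integrable (fun ω => Real.exp (llrAC lam A C n ω)) (P C) := by
    intro n
    by_contra hni
    have := hLR A C n Set.univ MeasurableSet.univ
    rw [Measure.restrict_univ, integral_undef hni] at this
    simp at this
  have hstep : ∀ n, P A (disjointed S n) ≤
      ENNReal.ofReal (Real.exp (-t)) * P C (disjointed S n) := by
    intro n
    have h1 : (P A (disjointed S n)).toReal ≤ Real.exp (-t) * (P C (disjointed S n)).toReal := by
      rw [hLR A C n _ (hD n)]
      have h2 : ∫ ω in disjointed S n, Real.exp (llrAC lam A C n ω) ∂ P C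
          ≤ ∫ ω in disjointed S n, Real.exp (-t) ∂ P C := by
        apply setIntegral_mono_on (hint n).integrableOn (integrable_const _).integrableOn
          (hFle n _ (hD n))
        intro ω hω
        exact Real.exp_le_exp.mpr (disjointed_subset S n hω)
      refine h2.trans (le_of_eq ?_)
      rw [setIntegral_const, smul_eq_mul, mul_comm]
      rfl
    rw [← ENNReal.ofReal_toReal (measure_ne_top (P A) (disjointed S n)),
      ← ENNReal.ofReal_toReal (measure_ne_top (P C) (disjointed S n)),
      ← ENNReal.ofReal_mul (Real.exp_pos _).le]
    exact ENNReal.ofReal_le_ofReal h1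
  have hU : {ω | ∃ n, llrAC lam A C n ω ≤ -t} = ⋃ n, disjointed S n := by
    rw [iUnion_disjointed]
    ext ω; simp [S]
  rw [hU]
  calc P A (⋃ n, disjointed S n) ≤ ∑' n, P A (disjointed S n) := measure_iUnion_le _
    _ ≤ ∑' n, ENNReal.ofReal (Real.exp (-t)) * P C (disjointed S n) := ENNReal.tsum_le_tsum hstep
    _ = ENNReal.ofReal (Real.exp (-t)) * P C (⋃ n, disjointed S n) := by
      rw [ENNReal.tsum_mul_left, measure_iUnion (disjoint_disjointed S)
        (fun n => hFle n _ (hD n))]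
    _ ≤ ENNReal.ofReal (Real.exp (-t)) * 1 := by gcongr; exact prob_le_one
    _ = _ := mul_one _

/-- Union bound in the shape needed for both error probabilities. -/
theorem union_bound {Ω : Type*} [MeasurableSpace Ω] {ι : Type*} (μ : Measure Ω)
    [IsProbabilityMeasure μ] (S B : Finset ι) (E : Set Ω) (G : ι → Set Ω) (H : ι → ι → Set Ω)
    (x y : ℝ) (hx : 0 ≤ x) (hy : 0 ≤ y)
    (hG : ∀ i ∈ S, μ (G i) ≤ ENNReal.ofReal x)
    (hH : ∀ i ∈ S, ∀ j ∈ B, μ (H i j) ≤ ENNReal.ofReal y)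
    (hE : ∀ᵐ ω ∂μ, ω ∈ E → ∃ i ∈ S, ω ∈ G i ∨ ∃ j ∈ B, ω ∈ H i j) :
    (μ E).toReal ≤ (S.card : ℝ) * (x + (B.card : ℝ) * y) := by
  have h1 : μ E ≤ μ (⋃ i ∈ S, (G i ∪ ⋃ j ∈ B, H i j)) := by
    apply measure_mono_ae
    filter_upwards [hE] with ω hω hωE
    obtain ⟨i, hi, h⟩ := hω hωE
    change ω ∈ ⋃ i ∈ S, (G i ∪ ⋃ j ∈ B, H i j)
    simp only [Set.mem_iUnion, Set.mem_union]
    refine ⟨i, hi, ?_⟩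
    rcases h with h | ⟨j, hj, h⟩
    · exact Or.inl h
    · exact Or.inr ⟨j, hj, h⟩
  have h2 : μ E ≤ ENNReal.ofReal ((S.card : ℝ) * (x + (B.card : ℝ) * y)) := by
    refine h1.trans ((measure_biUnion_finset_le _ _).trans ?_)
    have h3 : ∀ i ∈ S, μ (G i ∪ ⋃ j ∈ B, H i j) ≤ ENNReal.ofReal (x + (B.card : ℝ) * y) := by
      intro i hi
      refine (measure_union_le _ _).trans ?_
      rw [ENNReal.ofReal_add hx (by positivity)]
      refine add_le_add (hG i hi) ?_
      refine (measure_biUnion_finset_le _ _).trans ?_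
      refine (Finset.sum_le_sum (fun j hj => hH i hi j hj)).trans (le_of_eq ?_)
      rw [Finset.sum_const, nsmul_eq_mul, ENNReal.ofReal_mul (by positivity),
        ENNReal.ofReal_natCast]
    refine (Finset.sum_le_sum h3).trans (le_of_eq ?_)
    rw [Finset.sum_const, nsmul_eq_mul, ENNReal.ofReal_mul (by positivity),
      ENNReal.ofReal_natCast]
  exact ENNReal.toReal_le_of_le_ofReal (by positivity) h2

/-- **Theorem 3.2 (error control of the gap-intersection rule).**
Fix `0 ≤ ℓ < u ≤ K`, positive thresholds `a, b, c, d`, and `A` with `ℓ ≤ |A| ≤ u`.  Under the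
likelihood-ratio structure and the singularity assumption, `P_A(T_GI < ∞) = 1`,
`P_A(A ≲ d_GI) ≤ |Aᶜ|(e^{-b} + |A|e^{-c})` and `P_A(d_GI ≲ A) ≤ |A|(e^{-a} + |Aᶜ|e^{-d})`. -/
theorem gap_intersection_error_control
    {Ω : Type*} [MeasurableSpace Ω] {K : ℕ}
    (F : ℕ → MeasurableSpace Ω) (hFle : ∀ n, F n ≤ ‹MeasurableSpace Ω›)
    (hFmono : Monotone F)
    (P : Finset (Fin K) → Measure Ω) [∀ A : Finset (Fin K), IsProbabilityMeasure (P A)]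
    (lam : Fin K → ℕ → Ω → ℝ)
    (hadapt : ∀ (k : Fin K) (n : ℕ), Measurable[F n] fun ω => lam k n ω)
    (hLR : ∀ (A C : Finset (Fin K)) (n : ℕ) (Γ : Set Ω), MeasurableSet[F n] Γ →
      (P A Γ).toReal = ∫ ω in Γ, Real.exp (llrAC lam A C n ω) ∂ P C)
    (hdiv1 : ∀ (A : Finset (Fin K)) (k : Fin K), k ∈ A →
      ∀ᵐ ω ∂ P A, Tendsto (fun n => lam k n ω) atTop atTop)
    (hdiv0 : ∀ (A : Finset (Fin K)) (k : Fin K), k ∉ A →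
      ∀ᵐ ω ∂ P A, Tendsto (fun n => lam k n ω) atTop atBot)
    (ℓ u : ℕ) (hℓu : ℓ < u) (huK : u ≤ K)
    (a b c d : ℝ) (ha : 0 < a) (hb : 0 < b) (hc : 0 < c) (hd : 0 < d)
    (A : Finset (Fin K)) (hAl : ℓ ≤ A.card) (hAu : A.card ≤ u) :
    P A {ω | giTime lam ℓ u a b c d ω < ⊤} = 1 ∧
    (P A {ω | ¬ giDecision lam ℓ u a b c d ω ⊆ A}).toReal ≤
      ((K : ℝ) - A.card) * (Real.exp (-b) + (A.card : ℝ) * Real.exp (-c)) ∧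
    (P A {ω | ¬ A ⊆ giDecision lam ℓ u a b c d ω}).toReal ≤
      (A.card : ℝ) * (Real.exp (-a) + ((K : ℝ) - A.card) * Real.exp (-d)) := by
  have hmax := maximal_ineq F hFle hFmono P lam hadapt hLR
  have hfin : ∀ᵐ ω ∂ P A, giTime lam ℓ u a b c d ω < ⊤ := by
    have e1 : ∀ᵐ ω ∂ P A, ∀ k ∈ A, Tendsto (fun n => lam k n ω) atTop atTop := by
      rw [ae_all_iff]; intro k
      rw [ae_all_iff]; exact hdiv1 A k
    have e0 : ∀ᵐ ω ∂ P A, ∀ k, k ∉ A → Tendsto (fun n => lam k n ω) atTop atBot := by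
      rw [ae_all_iff]; intro k
      rw [ae_all_iff]; exact hdiv0 A k
    filter_upwards [e1, e0] with ω h1 h0
    have h2 : ∀ᶠ n in atTop, ∀ k, (k ∈ A → b ≤ lam k n ω) ∧ (k ∉ A → lam k n ω ≤ -a) := by
      rw [eventually_all]
      intro k
      by_cases hk : k ∈ A
      · filter_upwards [(h1 k hk).eventually_ge_atTop b] with n hn
        exact ⟨fun _ => hn, fun h => absurd hk h⟩
      · filter_upwards [(h0 k hk).eventually_le_atBot (-a)] with n hn
        exact ⟨fun h => absurd h hk, fun _ => hn⟩
    obtain ⟨n, hn, hn1⟩ := (h2.and (eventually_ge_atTop 1)).exists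
    have hpos : posCount (fun k => lam k n ω) = A.card := by
      unfold posCount
      congr 1
      ext k
      simp only [Finset.mem_filter, Finset.mem_univ, true_and]
      constructor
      · intro h
        by_contra hk
        have := (hn k).2 hk
        linarith
      · intro hk
        have := (hn k).1 hk
        linarith
    have ht2 : tau2 lam ℓ u a b ω < ⊤ := by
      refine stopTime_lt_top _ ω n hn1 ⟨by rw [hpos]; exact hAl, by rw [hpos]; exact hAu, ?_⟩
      rintro k ⟨hk1, hk2⟩
      by_cases hk : k ∈ A
      · have := (hn k).1 hk
        linarith
      · have := (hn k).2 hk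
        linarith
    exact lt_of_le_of_lt ((min_le_right _ _).trans (min_le_left _ _)) ht2
  have hcompl : ((Aᶜ.card : ℕ) : ℝ) = (K : ℝ) - A.card := by
    rw [Finset.card_compl, Fintype.card_fin, Nat.cast_sub (hAu.trans huK)]
  -- the basic likelihood ratio identities
  have llr_add : ∀ k, k ∉ A → ∀ n ω, llrAC lam A (insert k A) n ω = - lam k n ω := by
    intro k hk n ω
    have s1 : A \ insert k A = ∅ := by ext i; simp; tauto
    have s2 : insert k A \ A = {k} := by ext i; simp; grind
    simp [llrAC, s1, s2]
  have llr_del : ∀ j, j ∈ A → ∀ n ω, llrAC lam A (A.erase j) n ω = lam j n ω := by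
    intro j hj n ω
    have s1 : A \ A.erase j = {j} := by ext i; simp; grind
    have s2 : A.erase j \ A = ∅ := by ext i; simp
    simp [llrAC, s1, s2]
  have llr_swap : ∀ k, k ∉ A → ∀ j, j ∈ A → ∀ n ω,
      llrAC lam A (insert k (A.erase j)) n ω = lam j n ω - lam k n ω := by
    intro k hk j hj n ω
    have s1 : A \ insert k (A.erase j) = {j} := by ext i; simp; grind
    have s2 : insert k (A.erase j) \ A = {k} := by ext i; simp; grind
    simp [llrAC, s1, s2]
  have bAdd : ∀ k, k ∉ A → ∀ t, P A {ω | ∃ n, t ≤ lam k n ω} ≤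
      ENNReal.ofReal (Real.exp (-t)) := by
    intro k hk t
    refine (measure_mono ?_).trans (hmax A (insert k A) t)
    rintro ω ⟨n, hn⟩
    exact ⟨n, by rw [llr_add k hk]; linarith⟩
  have bDel : ∀ j, j ∈ A → ∀ t, P A {ω | ∃ n, lam j n ω ≤ -t} ≤
      ENNReal.ofReal (Real.exp (-t)) := by
    intro j hj t
    refine (measure_mono ?_).trans (hmax A (A.erase j) t)
    rintro ω ⟨n, hn⟩
    exact ⟨n, by rw [llr_del j hj]; linarith⟩
  have bSwap : ∀ k, k ∉ A → ∀ j, j ∈ A → ∀ t, P A {ω | ∃ n, t ≤ lam k n ω - lam j n ω} ≤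
      ENNReal.ofReal (Real.exp (-t)) := by
    intro k hk j hj t
    refine (measure_mono ?_).trans (hmax A (insert k (A.erase j)) t)
    rintro ω ⟨n, hn⟩
    exact ⟨n, by rw [llr_swap k hk j hj]; linarith⟩
  refine ⟨?_, ?_, ?_⟩
  · have := measure_eq_measure_of_null_sdiff (μ := P A)
      (Set.subset_univ {ω | giTime lam ℓ u a b c d ω < ⊤}) (by
        rw [← Set.compl_eq_univ_diff]; exact hfin)
    rw [this, measure_univ]
  · rw [← hcompl]
    refine union_bound (P A) Aᶜ A _ (fun k => {ω | ∃ n, b ≤ lam k n ω})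
      (fun k j => {ω | ∃ n, c ≤ lam k n ω - lam j n ω}) _ _ (Real.exp_pos _).le (Real.exp_pos _).le
      (fun k hk => bAdd k (Finset.mem_compl.mp hk) b)
      (fun k hk j hj => bSwap k (Finset.mem_compl.mp hk) j hj c) ?_
    filter_upwards [hfin] with ω hω hE
    obtain ⟨k, hk, hkA⟩ := Finset.not_subset.mp hE
    have hdet := (decision_det _ ℓ u hℓu huK a b c d ha hb A hAl hAu
      (giTime_spec lam ℓ u a b c d ω hω)).1 k hk hkA
    refine ⟨k, Finset.mem_compl.mpr hkA, ?_⟩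
    rcases hdet with h | ⟨j, hj, h⟩
    · exact Or.inl ⟨_, h⟩
    · exact Or.inr ⟨j, hj, _, h⟩
  · rw [← hcompl]
    refine union_bound (P A) A Aᶜ _ (fun j => {ω | ∃ n, lam j n ω ≤ -a})
      (fun j k => {ω | ∃ n, d ≤ lam k n ω - lam j n ω}) _ _ (Real.exp_pos _).le (Real.exp_pos _).le
      (fun j hj => bDel j hj a)
      (fun j hj k hk => bSwap k (Finset.mem_compl.mp hk) j hj d) ?_
    filter_upwards [hfin] with ω hω hE
    obtain ⟨j, hjA, hj⟩ := Finset.not_subset.mp hE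
    have hdet := (decision_det _ ℓ u hℓu huK a b c d ha hb A hAl hAu
      (giTime_spec lam ℓ u a b c d ω hω)).2 j hjA hj
    refine ⟨j, hjA, ?_⟩
    rcases hdet with h | ⟨k, hk, h⟩
    · exact Or.inl ⟨_, h⟩
    · exact Or.inr ⟨k, Finset.mem_compl.mpr hk, _, h⟩

end SeqMT
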